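/- arXiv:1404.0660 — 2 statements merged into one kernel-verified Lean document; each statement's English description precedes it below -/
import Mathlib

section
/- Let θ > 0 and let S : (1,∞) → (0,∞) satisfy S(x) = O(x) as x → ∞. For each pair α, β > 0 with αβ > 1 let v(αβ) > θ²·ρ^{−1} be the unique water level with ∑_{k=0}^∞ ( v(αβ) − θ²·ρ^{−(2k+1)} )⁺ = S(αβ). Then v is eventually bounded: there exist M > 1 and B < ∞ such that v(αβ) ≤ B whenever αβ > M (equivalently, limsup_{x→∞} v(x) < ∞, where v is viewed as a function of x = αβ). -/
/-- `dlt x` is δ = arccoth x, i.e. the positive solution of coth δ = x for x > 1. -/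
noncomputable def dlt (x : ℝ) : ℝ := (1/2) * Real.log ((x + 1) / (x - 1))

/-- `rho x` is ρ = e^{-δ} where coth δ = x. -/
noncomputable def rho (x : ℝ) : ℝ := Real.exp (-dlt x)

lemma dlt_pos {x : ℝ} (hx : 1 < x) : 0 < dlt x := by
  have h : 1 < (x + 1) / (x - 1) := by
    rw [one_lt_div (by linarith)]; linarith
  have := Real.log_pos h
  unfold dlt
  linarith

lemma dlt_mul_le_one {x : ℝ} (hx : 1 < x) : dlt x * (x - 1) ≤ 1 := by
  have hx' : 0 < x - 1 := by linarith
  have h := Real.log_le_sub_one_of_pos (show 0 < (x + 1) / (x - 1) by positivity)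
  have he : ((x + 1) / (x - 1) - 1) * (x - 1) = 2 := by field_simp; ring
  have := mul_le_mul_of_nonneg_right h hx'.le
  unfold dlt
  linarith

lemma div_rho_pow (a x : ℝ) (n : ℕ) : a / rho x ^ n = a * Real.exp (n * dlt x) := by
  rw [rho, ← Real.exp_nat_mul, div_eq_mul_inv, ← Real.exp_neg]
  congr 2
  ring

/-- Only finitely many subchannels lie below the water level. -/
lemma summable_water {a x : ℝ} (ha : 0 < a) (hx : 1 < x) (w : ℝ) :
    Summable fun k : ℕ => max 0 (w - a / rho x ^ (2 * k + 1)) := by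
  have hd := dlt_pos hx
  obtain ⟨N, hN⟩ := exists_nat_gt (w / (a * dlt x))
  rw [div_lt_iff₀ (by positivity)] at hN
  refine summable_of_ne_finset_zero (s := Finset.range N) fun k hk => ?_
  have hk : (N : ℝ) ≤ k := by
    exact_mod_cast not_lt.mp fun h => hk (Finset.mem_range.mpr h)
  refine max_eq_left ?_
  rw [div_rho_pow]
  have h1 := Real.add_one_le_exp (((2 * k + 1 : ℕ) : ℝ) * dlt x)
  have h2 : (N : ℝ) * dlt x ≤ ((2 * k + 1 : ℕ) : ℝ) * dlt x := by
    refine mul_le_mul_of_nonneg_right ?_ hd.le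
    push_cast
    linarith [(Nat.cast_nonneg k : (0 : ℝ) ≤ k)]
  have h3 : a * (N * dlt x) ≤ a * Real.exp (((2 * k + 1 : ℕ) : ℝ) * dlt x) := by
    gcongr
    linarith
  linarith

/-- The first `⌊x⌋` subchannels have noise variance at most `a * exp 4`. -/
lemma floor_mul_le_tsum_water {a x : ℝ} (ha : 0 < a) (hx : 2 ≤ x) (w : ℝ) :
    (⌊x⌋₊ : ℝ) * (w - a * Real.exp 4) ≤
      ∑' k : ℕ, max 0 (w - a / rho x ^ (2 * k + 1)) := by
  have hx1 : 1 < x := by linarith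
  have hd := dlt_pos hx1
  have hd1 := dlt_mul_le_one hx1
  refine le_trans ?_ ((summable_water ha hx1 w).sum_le_tsum (Finset.range ⌊x⌋₊)
    fun k _ => le_max_left _ _)
  rw [← nsmul_eq_mul]
  nth_rewrite 1 [← Finset.card_range ⌊x⌋₊]
  refine Finset.card_nsmul_le_sum _ _ _ fun k hk => le_trans ?_ (le_max_right _ _)
  rw [div_rho_pow]
  have hk' : (k : ℝ) + 1 ≤ x := by
    have h : k + 1 ≤ ⌊x⌋₊ := Finset.mem_range.mp hk
    have h' : ((k + 1 : ℕ) : ℝ) ≤ ⌊x⌋₊ := by exact_mod_cast h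
    push_cast at h'
    exact h'.trans (Nat.floor_le (by linarith))
  gcongr
  calc ((2 * k + 1 : ℕ) : ℝ) * dlt x ≤ (4 * (x - 1)) * dlt x := by
        gcongr
        push_cast
        linarith
    _ ≤ 4 := by linarith

/-- Eventual boundedness of the water level: if `S(x) = O(x)` as `x → ∞`, then the water
level `v(x)` determined by `∑_k (v − θ²·ρ^{−(2k+1)})⁺ = S` stays bounded for large `x = αβ`. -/
theorem water_level_eventually_bounded
    (θ : ℝ) (hθ : 0 < θ)
    (S : ℝ → ℝ) (hSpos : ∀ x, 1 < x → 0 < S x)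
    (hSO : ∃ c M : ℝ, 1 < M ∧ ∀ x, M < x → |S x| ≤ c * x)
    (v : ℝ → ℝ)
    (hv : ∀ x, 1 < x → θ^2 / rho x < v x)
    (hvS : ∀ x, 1 < x → (∑' k : ℕ, max 0 (v x - θ^2 / (rho x)^(2*k+1))) = S x) :
    ∃ M B : ℝ, 1 < M ∧ ∀ x, M < x → v x ≤ B := by
  obtain ⟨c, M, hM, hS⟩ := hSO
  refine ⟨max M 2, 2 * c + θ ^ 2 * Real.exp 4, lt_max_of_lt_left hM, fun x hx => ?_⟩
  obtain ⟨hMx, h2x⟩ := max_lt_iff.mp hx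
  have hSx := hS x hMx
  have hc : 0 ≤ c := by
    by_contra! h
    nlinarith [abs_nonneg (S x)]
  have hle := floor_mul_le_tsum_water (pow_pos hθ 2) h2x.le (v x)
  rw [hvS x (by linarith)] at hle
  have hfl := Nat.lt_floor_add_one x
  by_contra! hlt
  have h1 : x / 2 * (v x - θ ^ 2 * Real.exp 4) ≤ ⌊x⌋₊ * (v x - θ ^ 2 * Real.exp 4) := by
    refine mul_le_mul_of_nonneg_right ?_ (by linarith)
    linarith
  have h2 : x / 2 * (2 * c) < x / 2 * (v x - θ ^ 2 * Real.exp 4) :=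
    mul_lt_mul_of_pos_left (by linarith) (by linarith)
  linarith [le_abs_self (S x)]
end

section
/- Let σ > 0, set E(αβ) = ∑_{k=0}^∞ σ²·ρ^{2k+1}, and let D : (1,∞) → (0,∞) satisfy liminf_{x→∞} D(x)/x > 0 and 0 < D(αβ) < E(αβ) for all αβ > 1. For each pair α, β > 0 with αβ > 1 let w(αβ) ∈ (0, σ²·ρ) be the unique level with ∑_{k=0}^∞ min{ w(αβ), σ²·ρ^{2k+1} } = D(αβ). Then w is eventually bounded away from 0: there exist M > 1 and c > 0 such that w(αβ) ≥ c whenever αβ > M (equivalently, liminf_{x→∞} w(x) > 0, where w is viewed as a function of x = αβ). -/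
lemma rho_pos (x : ℝ) : 0 < rho x := Real.exp_pos _

lemma rho_sq {x : ℝ} (hx : 1 < x) : rho x ^ 2 = (x - 1) / (x + 1) := by
  have h : 0 < (x + 1) / (x - 1) := div_pos (by linarith) (by linarith)
  rw [rho, ← Real.exp_nat_mul, dlt,
    show ((2 : ℕ) : ℝ) * -(1 / 2 * Real.log ((x + 1) / (x - 1)))
      = -Real.log ((x + 1) / (x - 1)) by push_cast; ring,
    Real.exp_neg, Real.exp_log h, inv_div]

lemma rho_lt_one {x : ℝ} (hx : 1 < x) : rho x < 1 := by
  have h : rho x ^ 2 < 1 := by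
    rw [rho_sq hx, div_lt_one (by linarith)]
    linarith
  nlinarith [rho_pos x]

lemma inv_one_sub_rho_le {x : ℝ} (hx : 1 < x) : (1 - rho x)⁻¹ ≤ x + 1 := by
  have h1 := rho_lt_one hx
  have h2 : rho x ^ 2 * (x + 1) = x - 1 := by
    rw [rho_sq hx, div_mul_cancel₀ _ (by linarith)]
  rw [inv_le_iff_one_le_mul₀ (by linarith)]
  nlinarith [mul_nonneg (sq_nonneg (1 - rho x)) (by linarith : (0 : ℝ) ≤ x + 1)]

lemma min_sq_le_mul {a b : ℝ} (ha : 0 ≤ a) (hb : 0 ≤ b) : min (a ^ 2) (b ^ 2) ≤ a * b := by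
  rcases le_total a b with h | h
  · exact (min_le_left _ _).trans (by nlinarith)
  · exact (min_le_right _ _).trans (by nlinarith)

/-- Bounding each minimum by a geometric mean bounds the distortion by a geometric series. -/
lemma tsum_min_le {r s t : ℝ} (hr : 0 ≤ r) (hr1 : r < 1) (hs : 0 ≤ s) (ht : 0 ≤ t) :
    ∑' k : ℕ, min (t ^ 2) (s ^ 2 * r ^ (2 * k + 1)) ≤ t * s * (1 - r)⁻¹ := by
  have hle (k : ℕ) : min (t ^ 2) (s ^ 2 * r ^ (2 * k + 1)) ≤ t * s * r ^ k := by
    have hb : s ^ 2 * r ^ (2 * k + 1) ≤ (s * r ^ k) ^ 2 := by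
      have h : 0 ≤ (s * r ^ k) ^ 2 := sq_nonneg _
      calc s ^ 2 * r ^ (2 * k + 1) = (s * r ^ k) ^ 2 * r := by ring
        _ ≤ (s * r ^ k) ^ 2 := mul_le_of_le_one_right h hr1.le
    calc _ ≤ min (t ^ 2) ((s * r ^ k) ^ 2) := min_le_min_left _ hb
      _ ≤ t * (s * r ^ k) := min_sq_le_mul ht (by positivity)
      _ = t * s * r ^ k := by ring
  have hsum := (hasSum_geometric_of_lt_one hr hr1).mul_left (t * s)
  rw [← hsum.tsum_eq]
  exact (hsum.summable.of_nonneg_of_le (fun k => le_min (by positivity) (by positivity))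
    hle).tsum_le_tsum hle hsum.summable

/-- The ground-water table is eventually bounded away from zero: if `D(x) = Ω(x)` as
`x → ∞` and `0 < D < E`, then the level `w(x)` determined by
`∑_k min{w, σ²·ρ^{2k+1}} = D` satisfies `w(x) ≥ c > 0` for all large `x = αβ`. -/
theorem ground_water_table_eventually_bounded_below
    (σ : ℝ) (hσ : 0 < σ)
    (D : ℝ → ℝ) (hDpos : ∀ x, 1 < x → 0 < D x)
    (hDΩ : ∃ c M : ℝ, 0 < c ∧ 1 < M ∧ ∀ x, M < x → c * x ≤ D x)
    (hDE : ∀ x, 1 < x → D x < ∑' k : ℕ, σ^2 * (rho x)^(2*k+1))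
    (w : ℝ → ℝ)
    (hw : ∀ x, 1 < x → 0 < w x ∧ w x < σ^2 * rho x)
    (hwD : ∀ x, 1 < x → (∑' k : ℕ, min (w x) (σ^2 * (rho x)^(2*k+1))) = D x) :
    ∃ M c : ℝ, 1 < M ∧ 0 < c ∧ ∀ x, M < x → c ≤ w x := by
  obtain ⟨c, M, hc, hM, hD⟩ := hDΩ
  refine ⟨M, (c / (2 * σ)) ^ 2, hM, by positivity, fun x hx => ?_⟩
  have hx1 : 1 < x := hM.trans hx
  have hw0 := (hw x hx1).1.le
  have ht := Real.sqrt_nonneg (w x)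
  have hsum := tsum_min_le (rho_pos x).le (rho_lt_one hx1) hσ.le ht
  rw [Real.sq_sqrt hw0, hwD x hx1] at hsum
  have hbound : c * x ≤ √(w x) * σ * (2 * x) :=
    calc c * x ≤ √(w x) * σ * (1 - rho x)⁻¹ := (hD x hx).trans hsum
      _ ≤ √(w x) * σ * (2 * x) := by
        gcongr
        linarith [inv_one_sub_rho_le hx1]
  have hcσ : c ≤ √(w x) * (2 * σ) :=
    le_of_mul_le_mul_right (by linarith) (by linarith : 0 < x)
  rw [← Real.le_sqrt (by positivity) hw0, div_le_iff₀ (by positivity)]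
  exact hcσ
end
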